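/- arXiv:1202.6669 — 10 statements merged into one kernel-verified Lean document; each statement's English description precedes it below -/
import Mathlib

section
/- Fix reals P_T > 0, N > 0, J_Max > 0, an integer N_T ≥ 1, and a real J_Ave with 0 ≤ J_Ave ≤ ((N_T+1)/(2·N_T))·J_Max. Let y be the semi-uniform mixed strategy with parameter J_Ave. Then for every i ∈ {0,1,…,N_T}, the expected payoff of the transmitter's pure strategy i against y equals e_iᵀ C y = R_i · (1 − (2·(N_T − i)/(N_T+1))·(J_Ave/J_Max)). In particular e_{N_T}ᵀ C y = R_{N_T}. -/
open BigOperators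

/-- Rate `R_i = (1/2)·log(1 + P_T/(N + (i/N_T)·J_Max))`. -/
noncomputable def rate (P_T N J_Max : ℝ) (N_T i : ℕ) : ℝ :=
  (1 / 2) * Real.log (1 + P_T / (N + ((i : ℝ) / (N_T : ℝ)) * J_Max))

/-- Payoff matrix `C_{i,j} = R_i` if `j ≤ i`, else `0`. -/
noncomputable def payC (P_T N J_Max : ℝ) (N_T : ℕ) (i j : Fin (N_T + 1)) : ℝ :=
  if (j : ℕ) ≤ (i : ℕ) then rate P_T N J_Max N_T (i : ℕ) else 0

/-- The semi-uniform mixed strategy with parameter `J_Ave`. -/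
noncomputable def semiUniform (J_Max : ℝ) (N_T : ℕ) (J_Ave : ℝ) (j : Fin (N_T + 1)) : ℝ :=
  if (j : ℕ) = 0 then 1 - (2 * (N_T : ℝ) / ((N_T : ℝ) + 1)) * (J_Ave / J_Max)
  else (2 / ((N_T : ℝ) + 1)) * (J_Ave / J_Max)

theorem aux_sum (R a b : ℝ) (k n : ℕ) :
    ∑ j ∈ Finset.range (n + 1), (if j ≤ k then R else 0) * (if j = 0 then a else b)
      = R * (a + ((min k n : ℕ) : ℝ) * b) := by
  induction n with
  | zero => simp
  | succ n ih =>
    rw [Finset.sum_range_succ, ih]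
    by_cases h : n + 1 ≤ k
    · rw [min_eq_right h, min_eq_right (by omega : n ≤ k)]
      simp [h]
      ring
    · rw [min_eq_left (by omega : k ≤ n), min_eq_left (by omega : k ≤ n + 1)]
      simp [h]

theorem pure_payoff_against_semiUniform
    (P_T N J_Max : ℝ) (hP : 0 < P_T) (hN : 0 < N) (hJ : 0 < J_Max)
    (N_T : ℕ) (hNT : 1 ≤ N_T) (J_Ave : ℝ)
    (hJA0 : 0 ≤ J_Ave)
    (hJA1 : J_Ave ≤ (((N_T : ℝ) + 1) / (2 * (N_T : ℝ))) * J_Max) :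
    (∀ i : Fin (N_T + 1),
      ∑ j : Fin (N_T + 1), payC P_T N J_Max N_T i j * semiUniform J_Max N_T J_Ave j =
        rate P_T N J_Max N_T (i : ℕ) *
          (1 - (2 * ((N_T : ℝ) - (i : ℕ)) / ((N_T : ℝ) + 1)) * (J_Ave / J_Max))) ∧
    (∑ j : Fin (N_T + 1), payC P_T N J_Max N_T (Fin.last N_T) j * semiUniform J_Max N_T J_Ave j =
      rate P_T N J_Max N_T N_T) := by
  have key : ∀ i : Fin (N_T + 1),
      ∑ j : Fin (N_T + 1), payC P_T N J_Max N_T i j * semiUniform J_Max N_T J_Ave j =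
        rate P_T N J_Max N_T (i : ℕ) *
          (1 - (2 * ((N_T : ℝ) - (i : ℕ)) / ((N_T : ℝ) + 1)) * (J_Ave / J_Max)) := by
    intro i
    have h := aux_sum (rate P_T N J_Max N_T (i : ℕ))
      (1 - (2 * (N_T : ℝ) / ((N_T : ℝ) + 1)) * (J_Ave / J_Max))
      ((2 / ((N_T : ℝ) + 1)) * (J_Ave / J_Max)) (i : ℕ) N_T
    rw [Finset.sum_range, min_eq_left (by omega : (i : ℕ) ≤ N_T)] at h
    unfold payC semiUniform
    rw [h]
    ring
  refine ⟨key, ?_⟩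
  rw [key]
  simp
end

section
/- Fix reals P_T > 0, N > 0, J_Max > 0, an integer N_T ≥ 1, and a real J_Ave with 0 ≤ J_Ave ≤ ((N_T+1)/(2·N_T))·J_Max. Let y be the semi-uniform mixed strategy with parameter J_Ave, and for 0 ≤ i < N_T define Z_i = (1/2)·J_Max·((N_T+1)/(N_T−i))·(1 − R_{N_T}/R_i). Then for every i with 0 ≤ i < N_T: if J_Ave ≥ Z_i then e_{N_T}ᵀ C y ≥ e_iᵀ C y, i.e. the transmitter's lowest rate R_{N_T} yields an expected payoff against y at least as large as that of any other pure strategy i. -/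
open BigOperators

/-- `Z_i = (1/2)·J_Max·((N_T+1)/(N_T−i))·(1 − R_{N_T}/R_i)`. -/
noncomputable def Zthr (P_T N J_Max : ℝ) (N_T i : ℕ) : ℝ :=
  (1 / 2) * J_Max * (((N_T : ℝ) + 1) / ((N_T : ℝ) - (i : ℝ))) *
    (1 - rate P_T N J_Max N_T N_T / rate P_T N J_Max N_T i)

theorem row_payoff (P_T N J_Max : ℝ) (N_T : ℕ) (J_Ave : ℝ) (i : Fin (N_T + 1)) :
    ∑ j : Fin (N_T + 1), payC P_T N J_Max N_T i j * semiUniform J_Max N_T J_Ave j =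
      rate P_T N J_Max N_T (i : ℕ) *
        (1 - (2 / ((N_T : ℝ) + 1)) * (J_Ave / J_Max) * ((N_T : ℝ) - ((i : ℕ) : ℝ))) := by
  obtain ⟨i, hi⟩ := i
  have key : ∀ c : ℝ, ∑ j : Fin N_T, (if (j : ℕ) + 1 ≤ i then c else 0) = (i : ℝ) * c := by
    intro c
    rw [Fin.sum_univ_eq_sum_range (fun j => if j + 1 ≤ i then c else 0) N_T, ← Finset.sum_filter]
    have : (Finset.range N_T).filter (fun j => j + 1 ≤ i) = Finset.range i := by
      ext j
      simp only [Finset.mem_filter, Finset.mem_range]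
      omega
    rw [this]
    simp
  rw [Fin.sum_univ_succ]
  simp only [payC, semiUniform, Fin.val_succ, Fin.val_zero, Nat.succ_ne_zero, if_false, if_true,
    Nat.zero_le, ite_mul, zero_mul]
  rw [key]
  ring

theorem lowest_rate_beats_pure_strategy
    (P_T N J_Max : ℝ) (hP : 0 < P_T) (hN : 0 < N) (hJ : 0 < J_Max)
    (N_T : ℕ) (hNT : 1 ≤ N_T) (J_Ave : ℝ)
    (hJA0 : 0 ≤ J_Ave)
    (hJA1 : J_Ave ≤ (((N_T : ℝ) + 1) / (2 * (N_T : ℝ))) * J_Max) :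
    ∀ i : Fin (N_T + 1), (i : ℕ) < N_T →
      Zthr P_T N J_Max N_T (i : ℕ) ≤ J_Ave →
      ∑ j : Fin (N_T + 1), payC P_T N J_Max N_T i j * semiUniform J_Max N_T J_Ave j ≤
        ∑ j : Fin (N_T + 1),
          payC P_T N J_Max N_T (Fin.last N_T) j * semiUniform J_Max N_T J_Ave j := by
  intro i hi hZ
  rw [row_payoff, row_payoff]
  have hR : 0 < rate P_T N J_Max N_T (i : ℕ) := by
    unfold rate
    have h1 : 0 < P_T / (N + (((i : ℕ) : ℝ) / (N_T : ℝ)) * J_Max) := by positivity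
    have := Real.log_pos (x := 1 + P_T / (N + (((i : ℕ) : ℝ) / (N_T : ℝ)) * J_Max)) (by linarith)
    linarith
  have hd : (0 : ℝ) < (N_T : ℝ) - ((i : ℕ) : ℝ) := by
    have : ((i : ℕ) : ℝ) < (N_T : ℝ) := by exact_mod_cast hi
    linarith
  have hn : (0 : ℝ) < (N_T : ℝ) + 1 := by positivity
  unfold Zthr at hZ
  simp only [Fin.val_last, sub_self, mul_zero, sub_zero, mul_one]
  generalize rate P_T N J_Max N_T N_T = S at *
  generalize rate P_T N J_Max N_T (i : ℕ) = R at *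
  generalize (N_T : ℝ) - ((i : ℕ) : ℝ) = d at *
  generalize (N_T : ℝ) + 1 = n at *
  have h2 := mul_le_mul_of_nonneg_right hZ
    (show 0 ≤ 2 / n * d / J_Max * R by positivity)
  have e1 : 1 / 2 * J_Max * (n / d) * (1 - S / R) * (2 / n * d / J_Max * R) = R - S := by
    field_simp
  have e2 : J_Ave * (2 / n * d / J_Max * R) = R * (2 / n * (J_Ave / J_Max) * d) := by
    ring
  rw [e1, e2] at h2
  linarith
end

section
/- Fix reals P_T > 0, N > 0, J_Max > 0 and an integer N_T ≥ 1. Define J_{TH,U} = (1/2)·((N_T+1)/N_T)·(1 − R_{N_T}/R_0)·J_Max. For any real J_Ave with J_{TH,U} ≤ J_Ave ≤ ((N_T+1)/(2·N_T))·J_Max, let y be the semi-uniform mixed strategy with parameter J_Ave. Then for every mixed strategy x of the transmitter, xᵀ C y ≤ R_{N_T}; that is, the semi-uniform jammer forces the transmitter's expected payoff down to the lowest rate R_{N_T}. -/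
open BigOperators

lemma aux_log (P s : ℝ) (hP : 0 < P) (hs : 0 < s) :
    2 * P ≤ (2 * s + P) * (Real.log (s + P) - Real.log s) := by
  have h := Real.le_log_one_add_of_nonneg (x := P / s) (by positivity)
  have e : Real.log (1 + P / s) = Real.log (s + P) - Real.log s := by
    rw [← Real.log_div (by positivity) hs.ne']
    congr 1
    field_simp
  rw [e] at h
  have e2 : 2 * (P / s) / (P / s + 2) = 2 * P / (2 * s + P) := by
    field_simp
    ring
  rw [e2, div_le_iff₀ (by positivity)] at h
  linarith

lemma aux_concave (P : ℝ) (hP : 0 < P) :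
    ConcaveOn ℝ (Set.Ioi (0 : ℝ)) (fun s => (Real.log (s + P) - Real.log s)⁻¹) := by
  have hl : ∀ s : ℝ, 0 < s → 0 < Real.log (s + P) - Real.log s := fun s hs =>
    sub_pos.2 (Real.log_lt_log hs (by linarith))
  have hd : ∀ s : ℝ, 0 < s → HasDerivAt (fun s => Real.log (s + P) - Real.log s)
      (1 / (s + P) - s⁻¹) s := fun s hs =>
    (((hasDerivAt_id s).add_const P).log (by simp; positivity)).sub (Real.hasDerivAt_log hs.ne')
  have h1 : ∀ s : ℝ, 0 < s → HasDerivAt (fun s => (Real.log (s + P) - Real.log s)⁻¹)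
      (P * (s * (s + P) * (Real.log (s + P) - Real.log s) ^ 2)⁻¹) s := by
    intro s hs
    have hl' := hl s hs
    refine ((hd s hs).inv hl'.ne').congr_deriv ?_
    generalize Real.log (s + P) - Real.log s = l at *
    field_simp
    ring
  have h2 : ∀ s : ℝ, 0 < s → HasDerivAt
      (fun s => P * (s * (s + P) * (Real.log (s + P) - Real.log s) ^ 2)⁻¹)
      (-(P * (Real.log (s + P) - Real.log s) *
        ((2 * s + P) * (Real.log (s + P) - Real.log s) - 2 * P)) /
        (s * (s + P) * (Real.log (s + P) - Real.log s) ^ 2) ^ 2) s := by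
    intro s hs
    have hl' := hl s hs
    have hne : s * (s + P) * (Real.log (s + P) - Real.log s) ^ 2 ≠ 0 := by positivity
    have := (((((hasDerivAt_id s).mul ((hasDerivAt_id s).add_const P)).mul
      ((hd s hs).pow 2)).inv hne).const_mul P)
    refine HasDerivAt.congr_deriv this ?_
    simp only [id, Pi.mul_apply, Pi.pow_apply, Pi.sub_apply]
    generalize Real.log (s + P) - Real.log s = l at *
    field_simp
    ring
  refine concaveOn_of_hasDerivWithinAt2_nonpos (convex_Ioi 0)
    (f' := fun s => P * (s * (s + P) * (Real.log (s + P) - Real.log s) ^ 2)⁻¹)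
    (f'' := fun s => (-(P * (Real.log (s + P) - Real.log s) *
        ((2 * s + P) * (Real.log (s + P) - Real.log s) - 2 * P)) /
        (s * (s + P) * (Real.log (s + P) - Real.log s) ^ 2) ^ 2)) ?_ ?_ ?_ ?_
  · exact fun s hs => (h1 s hs).continuousAt.continuousWithinAt
  · intro s hs
    rw [interior_Ioi] at hs
    exact (h1 s hs).hasDerivWithinAt
  · intro s hs
    rw [interior_Ioi] at hs
    exact (h2 s hs).hasDerivWithinAt
  · intro s hs
    rw [interior_Ioi] at hs
    have := aux_log P s hP hs
    have h3 := hl s hs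
    rw [neg_div, neg_nonpos]
    have : 0 ≤ ((2 * s + P) * (Real.log (s + P) - Real.log s) - 2 * P) := by linarith
    positivity

lemma rate_eq (P N J : ℝ) (hP : 0 < P) (hN : 0 < N) (hJ : 0 < J) (n i : ℕ) :
    rate P N J n i = (1 / 2) * (Real.log (N + ((i : ℝ) / n) * J + P) -
      Real.log (N + ((i : ℝ) / n) * J)) := by
  have : 0 < N + ((i : ℝ) / n) * J := by positivity
  rw [rate, ← Real.log_div (by positivity) this.ne']
  congr 2
  field_simp

lemma rate_pos (P N J : ℝ) (hP : 0 < P) (hN : 0 < N) (hJ : 0 < J) (n i : ℕ) :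
    0 < rate P N J n i := by
  have : 0 < P / (N + ((i : ℝ) / n) * J) := by positivity
  have := Real.log_pos (x := 1 + P / (N + ((i : ℝ) / n) * J)) (by linarith)
  rw [rate]
  positivity

lemma rate_conc (P N J : ℝ) (hP : 0 < P) (hN : 0 < N) (hJ : 0 < J) (n i : ℕ) (hn : 1 ≤ n)
    (hi : i ≤ n) :
    (1 - (i : ℝ) / n) * (rate P N J n 0)⁻¹ + ((i : ℝ) / n) * (rate P N J n n)⁻¹
      ≤ (rate P N J n i)⁻¹ := by
  have hn0 : (0 : ℝ) < n := by exact_mod_cast hn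
  have ht : (i : ℝ) / n ≤ 1 := by
    rw [div_le_one hn0]; exact_mod_cast hi
  have hNJ : N + J ∈ Set.Ioi (0 : ℝ) := Set.mem_Ioi.2 (by positivity)
  have h := (aux_concave P hP).2 (Set.mem_Ioi.2 hN) hNJ
    (sub_nonneg.2 ht) (by positivity : (0 : ℝ) ≤ (i : ℝ) / n) (by ring)
  simp only [smul_eq_mul] at h
  have e : (1 - (i : ℝ) / n) * N + (i : ℝ) / n * (N + J) = N + ((i : ℝ) / n) * J := by ring
  rw [e] at h
  simp only [rate_eq P N J hP hN hJ, div_self hn0.ne', Nat.cast_zero, zero_div, zero_mul,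
    add_zero, one_mul, mul_inv]
  nlinarith [h]

lemma row_sum (P N J A : ℝ) (n : ℕ) (i : Fin (n + 1)) :
    ∑ j : Fin (n + 1), payC P N J n i j * semiUniform J n A j =
      rate P N J n i * (1 - (2 * (n : ℝ) / ((n : ℝ) + 1)) * (A / J) +
        (i : ℕ) * ((2 / ((n : ℝ) + 1)) * (A / J))) := by
  rw [Fin.sum_univ_succ]
  have : ∀ j : Fin n, payC P N J n i j.succ * semiUniform J n A j.succ =
      if (j : ℕ) < (i : ℕ) then rate P N J n i * ((2 / ((n : ℝ) + 1)) * (A / J)) else 0 := by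
    intro j
    simp [payC, semiUniform, Nat.succ_le_iff]
  simp only [this]
  rw [Fin.sum_univ_eq_sum_range (fun j => if j < (i : ℕ) then
    rate P N J n i * ((2 / ((n : ℝ) + 1)) * (A / J)) else 0) n, ← Finset.sum_filter]
  have : (Finset.range n).filter (fun j => j < (i : ℕ)) = Finset.range i := by
    ext j
    have := i.2
    simp
    omega
  rw [this]
  simp [payC, semiUniform]
  ring

theorem semiUniform_forces_lowest_rate
    (P_T N J_Max : ℝ) (hP : 0 < P_T) (hN : 0 < N) (hJ : 0 < J_Max)
    (N_T : ℕ) (hNT : 1 ≤ N_T) (J_Ave : ℝ)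
    (hJA0 : (1 / 2) * (((N_T : ℝ) + 1) / (N_T : ℝ)) *
        (1 - rate P_T N J_Max N_T N_T / rate P_T N J_Max N_T 0) * J_Max ≤ J_Ave)
    (hJA1 : J_Ave ≤ (((N_T : ℝ) + 1) / (2 * (N_T : ℝ))) * J_Max) :
    ∀ x : Fin (N_T + 1) → ℝ, (∀ i, 0 ≤ x i) → (∑ i, x i = 1) →
      ∑ i : Fin (N_T + 1), ∑ j : Fin (N_T + 1),
          x i * payC P_T N J_Max N_T i j * semiUniform J_Max N_T J_Ave j ≤
        rate P_T N J_Max N_T N_T := by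
  intro x hx hx1
  have key : ∀ i : Fin (N_T + 1),
      ∑ j : Fin (N_T + 1), payC P_T N J_Max N_T i j * semiUniform J_Max N_T J_Ave j ≤
        rate P_T N J_Max N_T N_T := by
    intro i
    rw [row_sum]
    have hi : (i : ℕ) ≤ N_T := Nat.lt_succ_iff.1 i.2
    have hc := rate_conc P_T N J_Max hP hN hJ N_T i hNT hi
    have p0 := rate_pos P_T N J_Max hP hN hJ N_T 0
    have p1 := rate_pos P_T N J_Max hP hN hJ N_T N_T
    have p2 := rate_pos P_T N J_Max hP hN hJ N_T i
    generalize rate P_T N J_Max N_T 0 = r0 at *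
    generalize rate P_T N J_Max N_T N_T = r1 at *
    generalize rate P_T N J_Max N_T i = r at *
    have hn0 : (0 : ℝ) < N_T := by exact_mod_cast hNT
    have ht : ((i : ℕ) : ℝ) / N_T ≤ 1 := by
      rw [div_le_one hn0]; exact_mod_cast hi
    have ha : 1 - r1 / r0 ≤ (2 * (N_T : ℝ) / ((N_T : ℝ) + 1)) * (J_Ave / J_Max) := by
      have : (2 * (N_T : ℝ) / ((N_T : ℝ) + 1)) * (((1 / 2) * (((N_T : ℝ) + 1) / (N_T : ℝ)) *
        (1 - r1 / r0) * J_Max) / J_Max) = 1 - r1 / r0 := by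
        field_simp
      rw [← this]
      gcongr
    have e : ((i : ℕ) : ℝ) * ((2 / ((N_T : ℝ) + 1)) * (J_Ave / J_Max)) =
        ((i : ℕ) : ℝ) / N_T * ((2 * (N_T : ℝ) / ((N_T : ℝ) + 1)) * (J_Ave / J_Max)) := by
      field_simp
    rw [e]
    generalize (2 * (N_T : ℝ) / ((N_T : ℝ) + 1)) * (J_Ave / J_Max) = a at *
    generalize ((i : ℕ) : ℝ) / N_T = t at *
    have h1 : 1 - a + t * a ≤ r1 * ((1 - t) * r0⁻¹ + t * r1⁻¹) := by
      have : r1 * ((1 - t) * r0⁻¹ + t * r1⁻¹) = 1 - (1 - t) * (1 - r1 / r0) := by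
        field_simp
        ring
      rw [this]
      nlinarith [mul_nonneg (sub_nonneg.2 ht) (sub_nonneg.2 ha)]
    calc r * (1 - a + t * a) ≤ r * (r1 * r⁻¹) := by
          gcongr
          exact h1.trans (by gcongr)
      _ = r1 := by field_simp
  calc _ = ∑ i, x i * ∑ j, payC P_T N J_Max N_T i j * semiUniform J_Max N_T J_Ave j := by
        simp only [Finset.mul_sum, mul_assoc]
    _ ≤ ∑ i, x i * rate P_T N J_Max N_T N_T :=
        Finset.sum_le_sum fun i _ => mul_le_mul_of_nonneg_left (key i) (hx i)
    _ = _ := by rw [← Finset.sum_mul, hx1, one_mul]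
end

section
/- Fix reals P_T > 0, N > 0, J_Max > 0 and an integer N_T ≥ 2. For 0 ≤ i < N_T define Z_i = (1/2)·J_Max·((N_T+1)/(N_T−i))·(1 − R_{N_T}/R_i), where R_i = (1/2)·log(1 + P_T/(N + (i/N_T)·J_Max)). Then Z_i is strictly decreasing in i: for all 0 ≤ i < i' < N_T one has Z_{i'} < Z_i. Consequently max_{0 ≤ i < N_T} Z_i = Z_0 = (1/2)·((N_T+1)/N_T)·(1 − R_{N_T}/R_0)·J_Max. -/
open BigOperators

lemma aux_g (P : ℝ) (hP : 0 < P) (x : ℝ) (hx : 0 < x) :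
    HasDerivAt (fun x : ℝ => Real.log (1 + P / x)) (-P / (x * (x + P))) x := by
  have h1 : HasDerivAt (fun x : ℝ => 1 + P / x) (P * (-(x ^ 2)⁻¹)) x := by
    simpa [div_eq_mul_inv] using ((hasDerivAt_inv hx.ne').const_mul P).const_add 1
  have h2 : (1 + P / x) ≠ 0 := by positivity
  convert h1.log h2 using 1
  have : x + P ≠ 0 := by positivity
  field_simp

lemma aux_q (P : ℝ) (hP : 0 < P) :
    StrictMonoOn (fun x : ℝ => x * (x + P) * (Real.log (1 + P / x)) ^ 2) (Set.Ioi 0) := by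
  have hd : ∀ x : ℝ, 0 < x → HasDerivAt (fun x : ℝ => x * (x + P) * (Real.log (1 + P / x)) ^ 2)
      (Real.log (1 + P / x) * ((2 * x + P) * Real.log (1 + P / x) - 2 * P)) x := by
    intro x hx
    have h1 := aux_g P hP x hx
    have h2 := ((hasDerivAt_id x).mul ((hasDerivAt_id x).add_const P)).mul (h1.pow 2)
    refine HasDerivAt.congr_deriv (f := _) h2 ?_
    simp [id, Pi.pow_apply, Pi.mul_apply]
    have : x + P ≠ 0 := by positivity
    field_simp
    ring
  apply strictMonoOn_of_deriv_pos (convex_Ioi 0)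
  · intro x hx
    exact (hd x hx).continuousAt.continuousWithinAt
  · intro x hx
    rw [interior_Ioi] at hx
    have hx0 : 0 < x := hx
    rw [(hd x hx0).deriv]
    have hu : 0 < P / x := by positivity
    have h3 := Real.lt_log_one_add_of_pos hu
    have h4 : 0 < Real.log (1 + P / x) := Real.log_pos (by linarith)
    have h5 : 2 * (P / x) / (P / x + 2) = 2 * P / (2 * x + P) := by
      field_simp
      ring
    rw [h5, div_lt_iff₀ (by positivity)] at h3
    apply mul_pos h4
    linarith

lemma aux_conc (P : ℝ) (hP : 0 < P) :
    StrictConcaveOn ℝ (Set.Ioi 0) (fun x : ℝ => (Real.log (1 + P / x))⁻¹) := by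
  have hpos : ∀ x : ℝ, 0 < x → 0 < Real.log (1 + P / x) := by
    intro x hx
    have hu : 0 < P / x := by positivity
    exact Real.log_pos (by linarith)
  have hd : ∀ x : ℝ, 0 < x → HasDerivAt (fun x : ℝ => (Real.log (1 + P / x))⁻¹)
      (P / (x * (x + P) * (Real.log (1 + P / x)) ^ 2)) x := by
    intro x hx
    have h0 := (hpos x hx).ne'
    have h2 := (aux_g P hP x hx).inv h0
    refine HasDerivAt.congr_deriv (f := _) h2 ?_
    have : x + P ≠ 0 := by positivity
    field_simp
  apply StrictAntiOn.strictConcaveOn_of_deriv (convex_Ioi 0)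
  · intro x hx
    exact (hd x hx).continuousAt.continuousWithinAt
  · rw [interior_Ioi]
    intro x hx y hy hxy
    have hx0 : 0 < x := hx
    have hy0 : 0 < y := hy
    rw [(hd x hx0).deriv, (hd y hy0).deriv]
    have := hpos x hx0
    exact div_lt_div_of_pos_left hP (by positivity) (aux_q P hP hx hy hxy)

theorem Z_strictly_decreasing_and_max_at_zero
    (P_T N J_Max : ℝ) (hP : 0 < P_T) (hN : 0 < N) (hJ : 0 < J_Max)
    (N_T : ℕ) (hNT : 2 ≤ N_T) :
    (∀ i i' : ℕ, i < i' → i' < N_T →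
      Zthr P_T N J_Max N_T i' < Zthr P_T N J_Max N_T i) ∧
    (∀ i : ℕ, i < N_T → Zthr P_T N J_Max N_T i ≤ Zthr P_T N J_Max N_T 0) ∧
    Zthr P_T N J_Max N_T 0 =
      (1 / 2) * (((N_T : ℝ) + 1) / (N_T : ℝ)) *
        (1 - rate P_T N J_Max N_T N_T / rate P_T N J_Max N_T 0) * J_Max := by
  have hn : (0 : ℝ) < N_T := by
    have : 0 < N_T := by omega
    exact_mod_cast this
  have key : ∀ i i' : ℕ, i < i' → i' < N_T →
      Zthr P_T N J_Max N_T i' < Zthr P_T N J_Max N_T i := by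
    intro i i' hi hi'
    have hxpos : ∀ j : ℕ, 0 < N + ((j : ℝ) / (N_T : ℝ)) * J_Max := fun j => by positivity
    have hlpos : ∀ j : ℕ, 0 < Real.log (1 + P_T / (N + ((j : ℝ) / (N_T : ℝ)) * J_Max)) := by
      intro j
      have := div_pos hP (hxpos j)
      exact Real.log_pos (by linarith)
    have hlt : ∀ j k : ℕ, j < k →
        N + ((j : ℝ) / (N_T : ℝ)) * J_Max < N + ((k : ℝ) / (N_T : ℝ)) * J_Max := by
      intro j k hjk
      have : (j : ℝ) < k := by exact_mod_cast hjk
      gcongr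
    have hZ : ∀ j : ℕ, j < N_T → Zthr P_T N J_Max N_T j =
        (1 / 2) * J_Max * ((N_T : ℝ) + 1) * (J_Max / N_T) *
        Real.log (1 + P_T / (N + ((N_T : ℝ) / (N_T : ℝ)) * J_Max)) *
        (((Real.log (1 + P_T / (N + ((j : ℝ) / (N_T : ℝ)) * J_Max)))⁻¹ -
          (Real.log (1 + P_T / (N + ((N_T : ℝ) / (N_T : ℝ)) * J_Max)))⁻¹) /
        ((N + ((j : ℝ) / (N_T : ℝ)) * J_Max) - (N + ((N_T : ℝ) / (N_T : ℝ)) * J_Max))) := by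
      intro j hj
      have hj' : (j : ℝ) < N_T := by exact_mod_cast hj
      have e : (N + ((j : ℝ) / (N_T : ℝ)) * J_Max) - (N + ((N_T : ℝ) / (N_T : ℝ)) * J_Max)
          = -(((N_T : ℝ) - j) * (J_Max / N_T)) := by ring
      rw [e]
      unfold Zthr rate
      have a1 := (hlpos j).ne'
      have a2 := (hlpos N_T).ne'
      generalize Real.log (1 + P_T / (N + ((j : ℝ) / (N_T : ℝ)) * J_Max)) = A at *
      generalize Real.log (1 + P_T / (N + ((N_T : ℝ) / (N_T : ℝ)) * J_Max)) = B at *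
      have a3 : (N_T : ℝ) - j ≠ 0 := by linarith
      field_simp
      ring
    rw [hZ i (hi.trans hi'), hZ i' hi']
    apply mul_lt_mul_of_pos_left
    · exact (aux_conc P_T hP).secant_strict_mono (hxpos N_T) (hxpos i) (hxpos i')
        (hlt _ _ (hi.trans hi')).ne (hlt _ _ hi').ne (hlt _ _ hi)
    · have := hlpos N_T
      positivity
  refine ⟨key, ?_, ?_⟩
  · intro i hi
    rcases Nat.eq_zero_or_pos i with h | h
    · rw [h]
    · exact (key 0 i h hi).le
  · unfold Zthr
    simp only [Nat.cast_zero, sub_zero]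
    ring
end

section
/- For all reals x and x_m with 0 < x_m < x, the following strict inequality holds: x·(x − x_m)·log(1 + x_m) − x_m·(1 + x)·log(1 + x)·(log(1 + x) − log(1 + x_m)) > 0. Equivalently, (x/(x_m·(1 + x))) · ((x − x_m)/(log(1 + x) − log(1 + x_m))) · (log(1 + x_m)/log(1 + x)) > 1. -/
lemma aux_convex : ConvexOn ℝ (Set.Ici 0) Real.sinh := by
  apply MonotoneOn.convexOn_of_deriv (convex_Ici 0) Real.continuous_sinh.continuousOn
    Real.differentiable_sinh.differentiableOn
  intro a ha b hb hab
  simp only [interior_Ici, Set.mem_Ioi] at ha hb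
  rw [Real.deriv_sinh, Real.cosh_le_cosh, abs_of_pos ha, abs_of_pos hb]
  exact hab

lemma aux_ratio (p q : ℝ) (hp : 0 < p) (hpq : p < q) :
    q * Real.sinh p ≤ p * Real.sinh q := by
  have hq : 0 < q := hp.trans hpq
  have hs : (0:ℝ) ≤ 1 - p / q := by rw [sub_nonneg, div_le_one hq]; exact hpq.le
  have h := aux_convex.2 (Set.mem_Ici.2 le_rfl) (Set.mem_Ici.2 hq.le)
    hs (by positivity : 0 ≤ p / q) (by ring)
  simp only [smul_eq_mul, mul_zero, zero_add, Real.sinh_zero, div_mul_cancel₀ _ hq.ne'] at h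
  have := mul_le_mul_of_nonneg_left h hq.le
  calc _ ≤ _ := this
    _ = _ := by field_simp

lemma aux_main (p q : ℝ) (hp : 0 < p) (hpq : p < q) :
    0 < (Real.exp (2*q) - 1) * (Real.exp (2*q) - Real.exp (2*p)) * (2*p)
      - (Real.exp (2*p) - 1) * Real.exp (2*q) * (2*q) * (2*q - 2*p) := by
  have hq : 0 < q := hp.trans hpq
  have h1 := aux_ratio p q hp hpq
  have h2 : q - p < Real.sinh (q - p) := Real.self_lt_sinh_iff.2 (by linarith)
  have h3 : 0 < Real.sinh p := Real.sinh_pos_iff.2 hp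
  have key : 0 < p * Real.sinh q * Real.sinh (q - p) - q * Real.sinh p * (q - p) := by
    have h4 : 0 < q * Real.sinh p := by positivity
    nlinarith [mul_le_mul_of_nonneg_right h1 (by linarith : (0:ℝ) ≤ Real.sinh (q-p)),
      mul_lt_mul_of_pos_left h2 h4]
  have e : (Real.exp (2*q) - 1) * (Real.exp (2*q) - Real.exp (2*p)) * (2*p)
      - (Real.exp (2*p) - 1) * Real.exp (2*q) * (2*q) * (2*q - 2*p)
      = 8 * (Real.exp p * Real.exp q ^ 2) *
        (p * Real.sinh q * Real.sinh (q - p) - q * Real.sinh p * (q - p)) := by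
    rw [Real.sinh_eq, Real.sinh_eq, Real.sinh_eq, neg_sub, Real.exp_sub, Real.exp_sub,
      Real.exp_neg, Real.exp_neg, two_mul q, two_mul p, Real.exp_add, Real.exp_add]
    have := Real.exp_pos p
    have := Real.exp_pos q
    field_simp
    ring
  rw [e]
  have := Real.exp_pos p
  have := Real.exp_pos q
  positivity

theorem log_jamming_inequality (x x_m : ℝ) (h0 : 0 < x_m) (h1 : x_m < x) :
    (x * (x - x_m) * Real.log (1 + x_m) -
      x_m * (1 + x) * Real.log (1 + x) * (Real.log (1 + x) - Real.log (1 + x_m)) > 0) ∧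
    ((x / (x_m * (1 + x))) * ((x - x_m) / (Real.log (1 + x) - Real.log (1 + x_m))) *
      (Real.log (1 + x_m) / Real.log (1 + x)) > 1) := by
  have ha : 0 < Real.log (1 + x_m) := Real.log_pos (by linarith)
  have hab : Real.log (1 + x_m) < Real.log (1 + x) :=
    Real.log_lt_log (by linarith) (by linarith)
  have hb := ha.trans hab
  have hx : 0 < x := h0.trans h1
  have m := aux_main (Real.log (1 + x_m) / 2) (Real.log (1 + x) / 2) (by linarith) (by linarith)
  simp only [mul_div_cancel₀ _ (two_ne_zero' ℝ)] at m
  rw [Real.exp_log (by linarith), Real.exp_log (by linarith)] at m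
  have F : x * (x - x_m) * Real.log (1 + x_m) -
      x_m * (1 + x) * Real.log (1 + x) * (Real.log (1 + x) - Real.log (1 + x_m)) > 0 := by
    ring_nf at m ⊢
    linarith
  refine ⟨F, ?_⟩
  have hd : 0 < Real.log (1 + x) - Real.log (1 + x_m) := by linarith
  rw [div_mul_div_comm, div_mul_div_comm, gt_iff_lt, lt_div_iff₀ (by positivity)]
  linarith
end

section
/- Fix reals P_T > 0, N > 0, J_Max > 0 and an integer N_T ≥ 1. There exists a real J_TH with 0 < J_TH < J_Max such that for every J_Ave with J_TH ≤ J_Ave ≤ J_Max there exists a mixed strategy y* of the jammer satisfying the average-power constraint Σ_{j=0}^{N_T} J_j · y*_j ≤ J_Ave, for which the transmitter's best achievable expected payoff is the lowest rate: for every mixed strategy x of the transmitter, xᵀ C y* ≤ R_{N_T}, and equality holds for the pure strategy x* = e_{N_T} placing probability 1 on the lowest rate. -/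
open BigOperators

/-- Jamming power level `J_j = (j/N_T)·J_Max`. -/
noncomputable def jamPow (J_Max : ℝ) (N_T j : ℕ) : ℝ := ((j : ℝ) / (N_T : ℝ)) * J_Max

/-- Mixed strategy: nonnegative entries summing to one. -/
def IsMixed {n : ℕ} (x : Fin n → ℝ) : Prop := (∀ i, 0 ≤ x i) ∧ ∑ i, x i = 1

/-- Expected payoff `xᵀ C y`. -/
noncomputable def payoff (P_T N J_Max : ℝ) (N_T : ℕ) (x y : Fin (N_T + 1) → ℝ) : ℝ :=
  ∑ i, ∑ j, x i * payC P_T N J_Max N_T i j * y j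

theorem rate_pos_aux (P_T N J_Max : ℝ) (hP : 0 < P_T) (hN : 0 < N) (hJ : 0 < J_Max)
    (N_T i : ℕ) : 0 < rate P_T N J_Max N_T i := by
  unfold rate
  have h : 0 < P_T / (N + ((i : ℝ) / (N_T : ℝ)) * J_Max) := by positivity
  have := Real.log_pos (show 1 < 1 + P_T / (N + ((i : ℝ) / (N_T : ℝ)) * J_Max) by linarith)
  linarith

theorem rate_le_aux (P_T N J_Max : ℝ) (hP : 0 < P_T) (hN : 0 < N) (hJ : 0 < J_Max)
    (N_T i : ℕ) : rate P_T N J_Max N_T i ≤ rate P_T N J_Max N_T 0 := by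
  unfold rate
  have h : 0 ≤ ((i : ℝ) / (N_T : ℝ)) * J_Max := by positivity
  have h2 : P_T / (N + ((i : ℝ) / (N_T : ℝ)) * J_Max) ≤
      P_T / (N + (((0 : ℕ) : ℝ) / (N_T : ℝ)) * J_Max) := by
    apply div_le_div_of_nonneg_left hP.le
    · simpa using hN
    · simpa using h
  have := Real.log_le_log (by positivity) (add_le_add_right h2 1)
  linarith

theorem rate_lt_aux (P_T N J_Max : ℝ) (hP : 0 < P_T) (hN : 0 < N) (hJ : 0 < J_Max)
    (N_T : ℕ) (hNT : 1 ≤ N_T) : rate P_T N J_Max N_T N_T < rate P_T N J_Max N_T 0 := by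
  unfold rate
  have hn : (0 : ℝ) < N_T := by exact_mod_cast hNT
  have h : 0 < ((N_T : ℝ) / (N_T : ℝ)) * J_Max := by positivity
  have h2 : P_T / (N + ((N_T : ℝ) / (N_T : ℝ)) * J_Max) <
      P_T / (N + (((0 : ℕ) : ℝ) / (N_T : ℝ)) * J_Max) := by
    apply div_lt_div_of_pos_left hP
    · simpa using hN
    · simpa using h
  have := Real.log_lt_log (by positivity) (add_lt_add_right h2 1)
  linarith

theorem exists_jamming_threshold
    (P_T N J_Max : ℝ) (hP : 0 < P_T) (hN : 0 < N) (hJ : 0 < J_Max)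
    (N_T : ℕ) (hNT : 1 ≤ N_T) :
    ∃ J_TH : ℝ, 0 < J_TH ∧ J_TH < J_Max ∧
      ∀ J_Ave : ℝ, J_TH ≤ J_Ave → J_Ave ≤ J_Max →
        ∃ ystar : Fin (N_T + 1) → ℝ, IsMixed ystar ∧
          (∑ j : Fin (N_T + 1), jamPow J_Max N_T (j : ℕ) * ystar j ≤ J_Ave) ∧
          (∀ x : Fin (N_T + 1) → ℝ, IsMixed x →
            payoff P_T N J_Max N_T x ystar ≤ rate P_T N J_Max N_T N_T) ∧
          payoff P_T N J_Max N_T (fun i => if i = Fin.last N_T then 1 else 0) ystar =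
            rate P_T N J_Max N_T N_T := by
  have hpos := rate_pos_aux P_T N J_Max hP hN hJ N_T
  have hle := rate_le_aux P_T N J_Max hP hN hJ N_T
  have hlt := rate_lt_aux P_T N J_Max hP hN hJ N_T hNT
  obtain ⟨ε, hε⟩ : ∃ ε, ε = rate P_T N J_Max N_T N_T / rate P_T N J_Max N_T 0 := ⟨_, rfl⟩
  have hε0 : 0 < ε := by rw [hε]; exact div_pos (hpos _) (hpos _)
  have hε1 : ε < 1 := by rw [hε]; exact (div_lt_one (hpos _)).2 hlt
  have hεR : rate P_T N J_Max N_T 0 * ε = rate P_T N J_Max N_T N_T := by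
    rw [hε]; exact mul_div_cancel₀ _ (hpos 0).ne'
  have hn : (N_T : ℝ) ≠ 0 := by
    have : N_T ≠ 0 := by omega
    exact_mod_cast this
  have hpay : ∀ x : Fin (N_T + 1) → ℝ, payoff P_T N J_Max N_T x
      (fun j => (if j = 0 then ε else 0) + (if j = Fin.last N_T then 1 - ε else 0)) =
      ∑ i, x i * (payC P_T N J_Max N_T i 0 * ε
        + payC P_T N J_Max N_T i (Fin.last N_T) * (1 - ε)) := by
    intro x
    unfold payoff
    refine Finset.sum_congr rfl fun i _ => ?_
    simp only [mul_add, Finset.sum_add_distrib, mul_ite, mul_zero, Finset.sum_ite_eq',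
      Finset.mem_univ, if_true]
    ring
  have hlast : payC P_T N J_Max N_T (Fin.last N_T) 0 * ε
      + payC P_T N J_Max N_T (Fin.last N_T) (Fin.last N_T) * (1 - ε)
      = rate P_T N J_Max N_T N_T := by
    simp [payC]
    ring
  refine ⟨(1 - ε) * J_Max, mul_pos (by linarith) hJ, by nlinarith, fun J h1 _ =>
    ⟨fun j => (if j = 0 then ε else 0) + (if j = Fin.last N_T then 1 - ε else 0),
      ⟨fun j => ?_, ?_⟩, ?_, fun x hx => ?_, ?_⟩⟩
  · have : 0 ≤ 1 - ε := by linarith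
    dsimp only
    positivity
  · simp [Finset.sum_add_distrib]
  · refine le_trans (le_of_eq ?_) h1
    simp [mul_add, Finset.sum_add_distrib, jamPow, hn]
    ring
  · rw [hpay]
    calc _ ≤ ∑ i, x i * rate P_T N J_Max N_T N_T := by
          refine Finset.sum_le_sum fun i _ => mul_le_mul_of_nonneg_left ?_ (hx.1 i)
          by_cases hi : i = Fin.last N_T
          · rw [hi, hlast]
          · have hi' : ¬ N_T ≤ (i : ℕ) := by
              intro h
              apply hi
              ext
              simp
              omega
            simp only [payC, Fin.val_last, hi', if_false, Fin.val_zero, Nat.zero_le, if_true]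
            nlinarith [hle i]
      _ = _ := by rw [← Finset.sum_mul, hx.2, one_mul]
  · rw [hpay]
    simp only [ite_mul, zero_mul, one_mul, Finset.sum_ite_eq', Finset.mem_univ, if_true]
    exact hlast
end

section
/- Fix reals P_T > 0, N > 0, J_Max > 0, an integer N_T ≥ 1, and an integer m with 0 ≤ m ≤ N_T − 1. Define α_m by α_m⁻¹ = Σ_{i=0}^{m} (R_i)⁻¹ and let x̂ be the transmitter mixed strategy with x̂_i = α_m/R_i for 0 ≤ i ≤ m and x̂_i = 0 for i > m. Then for every mixed strategy y of the jammer that is supported on indices {0,1,…,m+1} (i.e. y_j = 0 for all j > m+1), the expected payoff satisfies x̂ᵀ C y = α_m · ((m+1) − Σ_{j=0}^{N_T} j·y_j). -/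
open BigOperators

/-- `α_m = (Σ_{i=0}^{m} R_i⁻¹)⁻¹`. -/
noncomputable def alpha (P_T N J_Max : ℝ) (N_T m : ℕ) : ℝ :=
  (∑ i ∈ Finset.range (m + 1), (rate P_T N J_Max N_T i)⁻¹)⁻¹

/-- Transmitter strategy `x̂` with `x̂_i = α_m / R_i` for `i ≤ m` and `0` otherwise. -/
noncomputable def xhat (P_T N J_Max : ℝ) (N_T m : ℕ) (i : Fin (N_T + 1)) : ℝ :=
  if (i : ℕ) ≤ m then alpha P_T N J_Max N_T m / rate P_T N J_Max N_T (i : ℕ) else 0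

theorem xhat_payoff_on_supported_strategies
    (P_T N J_Max : ℝ) (hP : 0 < P_T) (hN : 0 < N) (hJ : 0 < J_Max)
    (N_T : ℕ) (hNT : 1 ≤ N_T) (m : ℕ) (hm : m ≤ N_T - 1) :
    ∀ y : Fin (N_T + 1) → ℝ, IsMixed y → (∀ j : Fin (N_T + 1), m + 1 < (j : ℕ) → y j = 0) →
      payoff P_T N J_Max N_T (xhat P_T N J_Max N_T m) y =
        alpha P_T N J_Max N_T m *
          (((m : ℝ) + 1) - ∑ j : Fin (N_T + 1), (j : ℝ) * y j) := by
  intro y hy hs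
  have hR : ∀ i : ℕ, rate P_T N J_Max N_T i ≠ 0 := by
    intro i
    have h1 : 0 < P_T / (N + ((i : ℝ) / (N_T : ℝ)) * J_Max) := by positivity
    have h2 : 0 < Real.log (1 + P_T / (N + ((i : ℝ) / (N_T : ℝ)) * J_Max)) :=
      Real.log_pos (by linarith)
    unfold rate
    positivity
  have hcount : ∀ k : ℕ, k ≤ m + 1 →
      (∑ i : Fin (N_T + 1), if k ≤ (i : ℕ) ∧ (i : ℕ) ≤ m then (1 : ℝ) else 0)
        = (m : ℝ) + 1 - k := by
    intro k hk
    rw [Fin.sum_univ_eq_sum_range (fun i : ℕ => if k ≤ i ∧ i ≤ m then (1 : ℝ) else 0) (N_T + 1),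
      ← Finset.sum_filter]
    have : (Finset.range (N_T + 1)).filter (fun i => k ≤ i ∧ i ≤ m) = Finset.Ico k (m + 1) := by
      ext i
      simp only [Finset.mem_filter, Finset.mem_range, Finset.mem_Ico]
      omega
    rw [this]
    simp [Nat.cast_sub hk]
  unfold payoff
  rw [Finset.sum_comm]
  have hcol : ∀ j : Fin (N_T + 1),
      ∑ i, xhat P_T N J_Max N_T m i * payC P_T N J_Max N_T i j * y j
        = alpha P_T N J_Max N_T m * (((m : ℝ) + 1) * y j - (j : ℝ) * y j) := by
    intro j
    by_cases hj : (j : ℕ) ≤ m + 1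
    · rw [← sub_mul, ← hcount j hj, ← Finset.sum_mul, ← mul_assoc, Finset.mul_sum]
      congr 1
      refine Finset.sum_congr rfl fun i _ => ?_
      have := hR i
      unfold xhat payC
      by_cases h1 : (i : ℕ) ≤ m <;> by_cases h2 : (j : ℕ) ≤ (i : ℕ) <;> simp [h1, h2, this]
    · simp [hs j (by omega)]
  rw [Finset.sum_congr rfl fun j _ => hcol j, ← Finset.mul_sum, Finset.sum_sub_distrib,
    ← Finset.mul_sum, hy.2, mul_one]
end

section
/- Fix reals P_T > 0, N > 0, J_Max > 0, an integer N_T ≥ 1, and an integer m with 0 ≤ m ≤ N_T − 1. Define α_m by α_m⁻¹ = Σ_{i=0}^{m} (R_i)⁻¹, let x̂ be the transmitter mixed strategy with x̂_i = α_m/R_i for 0 ≤ i ≤ m and x̂_i = 0 for i > m, and set J_{Ave,m} = ((m+1) − α_m⁻¹·R_{m+1})·(J_Max/N_T). Then for EVERY mixed strategy y of the jammer (with no support restriction), x̂ᵀ C y ≥ α_m·((m+1) − Σ_{j=0}^{N_T} j·y_j). In particular, for every y satisfying the average-power constraint Σ_j J_j·y_j ≤ J_{Ave,m} (where J_j = (j/N_T)·J_Max),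 one has x̂ᵀ C y ≥ R_{m+1}. -/
open BigOperators

/-- `J_{Ave,m} = ((m+1) − α_m⁻¹·R_{m+1})·(J_Max/N_T)`. -/
noncomputable def JAvem (P_T N J_Max : ℝ) (N_T m : ℕ) : ℝ :=
  (((m : ℝ) + 1) - (alpha P_T N J_Max N_T m)⁻¹ * rate P_T N J_Max N_T (m + 1)) *
    (J_Max / (N_T : ℝ))

theorem alpha_pos_aux (P_T N J_Max : ℝ) (hP : 0 < P_T) (hN : 0 < N) (hJ : 0 < J_Max)
    (N_T m : ℕ) : 0 < alpha P_T N J_Max N_T m := by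
  unfold alpha
  apply inv_pos.2
  apply Finset.sum_pos
  · intro i _
    exact inv_pos.2 (rate_pos_aux P_T N J_Max hP hN hJ N_T i)
  · simp

theorem col_aux (P_T N J_Max : ℝ) (hP : 0 < P_T) (hN : 0 < N) (hJ : 0 < J_Max)
    (N_T m : ℕ) (hm : m ≤ N_T) (j : Fin (N_T + 1)) :
    alpha P_T N J_Max N_T m * (((m : ℝ) + 1) - ((j : ℕ) : ℝ)) ≤
      ∑ i, xhat P_T N J_Max N_T m i * payC P_T N J_Max N_T i j := by
  have ha := alpha_pos_aux P_T N J_Max hP hN hJ N_T m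
  have h1 : ∀ i : Fin (N_T + 1), xhat P_T N J_Max N_T m i * payC P_T N J_Max N_T i j =
      (fun k : ℕ => if k ∈ Finset.Icc (j : ℕ) m then alpha P_T N J_Max N_T m else 0) (i : ℕ) := by
    intro i
    have hr := (rate_pos_aux P_T N J_Max hP hN hJ N_T i).ne'
    simp only [xhat, payC, Finset.mem_Icc]
    by_cases h : (i : ℕ) ≤ m <;> by_cases h' : (j : ℕ) ≤ (i : ℕ) <;> simp [h, h']
    field_simp
  rw [Finset.sum_congr rfl (fun i _ => h1 i), Fin.sum_univ_eq_sum_range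
    (fun k : ℕ => if k ∈ Finset.Icc (j : ℕ) m then alpha P_T N J_Max N_T m else 0), Finset.sum_ite_mem,
    Finset.inter_eq_right.2 (by
      intro k hk
      simp only [Finset.mem_Icc, Finset.mem_range] at *
      omega), Finset.sum_const, Nat.card_Icc, nsmul_eq_mul, mul_comm]
  apply mul_le_mul_of_nonneg_right _ ha.le
  have : m + 1 ≤ (m + 1 - (j : ℕ)) + (j : ℕ) := by omega
  have h2 : ((m : ℝ) + 1) ≤ ((m + 1 - (j : ℕ) : ℕ) : ℝ) + ((j : ℕ) : ℝ) := by exact_mod_cast this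
  linarith

theorem xhat_guarantees_Rmplus1
    (P_T N J_Max : ℝ) (hP : 0 < P_T) (hN : 0 < N) (hJ : 0 < J_Max)
    (N_T : ℕ) (hNT : 1 ≤ N_T) (m : ℕ) (hm : m ≤ N_T - 1) :
    (∀ y : Fin (N_T + 1) → ℝ, IsMixed y →
      alpha P_T N J_Max N_T m * (((m : ℝ) + 1) - ∑ j : Fin (N_T + 1), (j : ℝ) * y j) ≤
        payoff P_T N J_Max N_T (xhat P_T N J_Max N_T m) y) ∧
    (∀ y : Fin (N_T + 1) → ℝ, IsMixed y →
      (∑ j : Fin (N_T + 1), jamPow J_Max N_T (j : ℕ) * y j ≤ JAvem P_T N J_Max N_T m) →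
      rate P_T N J_Max N_T (m + 1) ≤
        payoff P_T N J_Max N_T (xhat P_T N J_Max N_T m) y) := by
  have key : ∀ y : Fin (N_T + 1) → ℝ, IsMixed y →
      alpha P_T N J_Max N_T m * (((m : ℝ) + 1) - ∑ j : Fin (N_T + 1), (j : ℝ) * y j) ≤
        payoff P_T N J_Max N_T (xhat P_T N J_Max N_T m) y := by
    intro y hy
    unfold payoff
    rw [Finset.sum_comm]
    have e : alpha P_T N J_Max N_T m * (((m : ℝ) + 1) - ∑ j : Fin (N_T + 1), (j : ℝ) * y j) =
        ∑ j : Fin (N_T + 1), alpha P_T N J_Max N_T m * (((m : ℝ) + 1) - (j : ℝ)) * y j := by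
      have : ∀ j : Fin (N_T + 1), alpha P_T N J_Max N_T m * (((m : ℝ) + 1) - (j : ℝ)) * y j =
          alpha P_T N J_Max N_T m * (((m : ℝ) + 1) * y j - (j : ℝ) * y j) := fun j => by ring
      rw [Finset.sum_congr rfl (fun j _ => this j), ← Finset.mul_sum, Finset.sum_sub_distrib,
        ← Finset.mul_sum, hy.2, mul_one]
    rw [e]
    apply Finset.sum_le_sum
    intro j _
    rw [← Finset.sum_mul]
    exact mul_le_mul_of_nonneg_right
      (col_aux P_T N J_Max hP hN hJ N_T m (by omega) j) (hy.1 j)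
  refine ⟨key, fun y hy hc => le_trans ?_ (key y hy)⟩
  have ha := alpha_pos_aux P_T N J_Max hP hN hJ N_T m
  have hT : (0 : ℝ) < N_T := by exact_mod_cast hNT
  have hd : 0 < J_Max / (N_T : ℝ) := by positivity
  have e : ∑ j : Fin (N_T + 1), jamPow J_Max N_T (j : ℕ) * y j =
      (∑ j : Fin (N_T + 1), (j : ℝ) * y j) * (J_Max / (N_T : ℝ)) := by
    rw [Finset.sum_mul]
    refine Finset.sum_congr rfl fun j _ => ?_
    unfold jamPow
    ring
  rw [e] at hc
  unfold JAvem at hc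
  have h := le_of_mul_le_mul_right hc hd
  have h2 : (alpha P_T N J_Max N_T m)⁻¹ * rate P_T N J_Max N_T (m + 1) ≤
      ((m : ℝ) + 1) - ∑ j : Fin (N_T + 1), (j : ℝ) * y j := by linarith
  calc rate P_T N J_Max N_T (m + 1) = alpha P_T N J_Max N_T m *
        ((alpha P_T N J_Max N_T m)⁻¹ * rate P_T N J_Max N_T (m + 1)) := by
        rw [mul_inv_cancel_left₀ ha.ne']
    _ ≤ _ := mul_le_mul_of_nonneg_left h2 ha.le
end

section
/- Fix reals P_T > 0, N > 0, J_Max > 0, an integer N_T ≥ 1, and an integer m with 0 ≤ m ≤ N_T − 1. Define the vector ŷ ∈ ℝ^{N_T+1} by ŷ_0 = R_{m+1}/R_0, ŷ_j = R_{m+1}·(1/R_j − 1/R_{j−1}) for 1 ≤ j ≤ m+1, and ŷ_j = 0 for j > m+1. Then ŷ is a mixed strategy (all entries are nonnegative and sum to 1), and its average jamming power equals Σ_{j=0}^{N_T} J_j·ŷ_j = ((m+1) − α_m⁻¹·R_{m+1})·(J_Max/N_T), where J_j = (j/N_T)·J_Max and α_m⁻¹ = Σ_{i=0}^{m} (R_i)⁻¹.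 -/
open BigOperators

/-- Jammer strategy `ŷ`: `ŷ_0 = R_{m+1}/R_0`, `ŷ_j = R_{m+1}·(1/R_j − 1/R_{j−1})`
for `1 ≤ j ≤ m+1`, and `ŷ_j = 0` for `j > m+1`. -/
noncomputable def yhat (P_T N J_Max : ℝ) (N_T m : ℕ) (j : Fin (N_T + 1)) : ℝ :=
  if (j : ℕ) = 0 then rate P_T N J_Max N_T (m + 1) / rate P_T N J_Max N_T 0
  else if (j : ℕ) ≤ m + 1 then
    rate P_T N J_Max N_T (m + 1) *
      ((rate P_T N J_Max N_T (j : ℕ))⁻¹ - (rate P_T N J_Max N_T ((j : ℕ) - 1))⁻¹)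
  else 0

theorem rate_anti_aux (P_T N J_Max : ℝ) (hP : 0 < P_T) (hN : 0 < N) (hJ : 0 < J_Max)
    (N_T i k : ℕ) (hik : i ≤ k) : rate P_T N J_Max N_T k ≤ rate P_T N J_Max N_T i := by
  unfold rate
  have : (i : ℝ) ≤ k := by exact_mod_cast hik
  gcongr

theorem sum_trunc_aux (n m : ℕ) (hm : m + 1 ≤ n) (c : ℕ → ℝ) (r : ℕ → ℝ) (w : ℝ) :
    ∑ j : Fin (n + 1), c j * (if (j : ℕ) = 0 then w / r 0
      else if (j : ℕ) ≤ m + 1 then w * ((r (j : ℕ))⁻¹ - (r ((j : ℕ) - 1))⁻¹) else 0)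
    = c 0 * (w / r 0) + ∑ j ∈ Finset.range (m + 1), c (j + 1) * (w * ((r (j + 1))⁻¹ - (r j)⁻¹)) := by
  rw [Fin.sum_univ_eq_sum_range (fun j => c j * (if j = 0 then w / r 0
      else if j ≤ m + 1 then w * ((r j)⁻¹ - (r (j - 1))⁻¹) else 0)) (n + 1),
    ← Finset.sum_subset (Finset.range_subset_range.2 (show m + 1 + 1 ≤ n + 1 by omega)),
    Finset.sum_range_succ', add_comm]
  · congr 1
    apply Finset.sum_congr rfl
    intro j hj
    have := Finset.mem_range.1 hj
    rw [if_neg (by omega), if_pos (by omega), Nat.add_sub_cancel]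
  · intro j _ hj
    have : ¬ j < m + 1 + 1 := fun h => hj (Finset.mem_range.2 h)
    rw [if_neg (by omega), if_neg (by omega), mul_zero]

theorem sum_one_aux (r : ℕ → ℝ) (w : ℝ) (k : ℕ) :
    w / r 0 + ∑ j ∈ Finset.range k, w * ((r (j + 1))⁻¹ - (r j)⁻¹) = w * (r k)⁻¹ := by
  rw [← Finset.mul_sum, Finset.sum_range_sub (fun j => (r j)⁻¹)]
  ring

theorem sum_pow_aux (r : ℕ → ℝ) (w n J : ℝ) (k : ℕ) :
    ∑ j ∈ Finset.range k, (((j + 1 : ℕ) : ℝ) / n * J) * (w * ((r (j + 1))⁻¹ - (r j)⁻¹))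
      = (k * (w * (r k)⁻¹) - (∑ i ∈ Finset.range k, (r i)⁻¹) * w) * (J / n) := by
  induction k with
  | zero => simp
  | succ k ih =>
    rw [Finset.sum_range_succ, ih, Finset.sum_range_succ]
    push_cast
    ring

theorem yhat_isMixed_and_avg_power
    (P_T N J_Max : ℝ) (hP : 0 < P_T) (hN : 0 < N) (hJ : 0 < J_Max)
    (N_T : ℕ) (hNT : 1 ≤ N_T) (m : ℕ) (hm : m ≤ N_T - 1) :
    (∀ j : Fin (N_T + 1), 0 ≤ yhat P_T N J_Max N_T m j) ∧
    (∑ j : Fin (N_T + 1), yhat P_T N J_Max N_T m j = 1) ∧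
    (∑ j : Fin (N_T + 1), jamPow J_Max N_T (j : ℕ) * yhat P_T N J_Max N_T m j =
      (((m : ℝ) + 1) -
          (∑ i ∈ Finset.range (m + 1), (rate P_T N J_Max N_T i)⁻¹) *
            rate P_T N J_Max N_T (m + 1)) *
        (J_Max / (N_T : ℝ))) := by
  have hpos := rate_pos_aux P_T N J_Max hP hN hJ N_T
  have hm' : m + 1 ≤ N_T := by omega
  refine ⟨?_, ?_, ?_⟩
  · intro j
    unfold yhat
    split_ifs
    · exact (div_pos (hpos _) (hpos _)).le
    · apply mul_nonneg (hpos _).le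
      rw [sub_nonneg]
      exact inv_anti₀ (hpos _)
        (rate_anti_aux P_T N J_Max hP hN hJ N_T _ _ (Nat.sub_le _ _))
    · exact le_rfl
  · have h := sum_trunc_aux N_T m hm' (fun _ => 1) (rate P_T N J_Max N_T)
      (rate P_T N J_Max N_T (m + 1))
    simp only [one_mul] at h
    rw [sum_one_aux, mul_inv_cancel₀ (hpos _).ne'] at h
    exact h
  · have h := sum_trunc_aux N_T m hm' (jamPow J_Max N_T) (rate P_T N J_Max N_T)
      (rate P_T N J_Max N_T (m + 1))
    refine h.trans ?_
    unfold jamPow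
    rw [sum_pow_aux, mul_inv_cancel₀ (hpos _).ne']
    push_cast
    ring
end

section
/- Fix reals P_T > 0, N > 0, J_Max > 0 and integers N_T, N_J with 1 ≤ N_T < N_J. The transmitter's assumed jamming levels are J_{T,i} = (i/N_T)·J_Max for i ∈ {0,…,N_T}, and the jammer's power levels are J'_j = (j/N_J)·J_Max for j ∈ {0,…,N_J}; the payoff when the transmitter plays i and the jammer plays j is U(i,j) = R_i if J'_j ≤ J_{T,i} and U(i,j) = 0 otherwise, where R_i = (1/2)·log(1 + P_T/(N + (i/N_T)·J_Max)). Then there exist indices j, j' with 0 ≤ j < j' ≤ N_J whose payoff columns coincide: U(i, j) = U(i, j') for every i ∈ {0,…,N_T}. (Hence the higher-power strategy j' is redundant for the jammer, so at most N_T + 1 of the jammer's N_J + 1 pure strategies are non-dominated.) -/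
open BigOperators

/-- Payoff `U(i,j)` when the transmitter assumes jamming level `(i/N_T)·J_Max`
and the jammer uses power `(j/N_J)·J_Max`. -/
noncomputable def Upay (P_T N J_Max : ℝ) (N_T N_J : ℕ)
    (i : Fin (N_T + 1)) (j : Fin (N_J + 1)) : ℝ :=
  if ((j : ℝ) / (N_J : ℝ)) * J_Max ≤ ((i : ℝ) / (N_T : ℝ)) * J_Max then
    rate P_T N J_Max N_T (i : ℕ)
  else 0

theorem jammer_has_redundant_column
    (P_T N J_Max : ℝ) (hP : 0 < P_T) (hN : 0 < N) (hJ : 0 < J_Max)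
    (N_T N_J : ℕ) (hNT : 1 ≤ N_T) (hlt : N_T < N_J) :
    ∃ j j' : Fin (N_J + 1), (j : ℕ) < (j' : ℕ) ∧
      ∀ i : Fin (N_T + 1),
        Upay P_T N J_Max N_T N_J i j = Upay P_T N J_Max N_T N_J i j' := by
  have hNJ : 0 < N_J := by omega
  have key : ∀ (i : Fin (N_T + 1)) (j : Fin (N_J + 1)),
      ((((j : ℕ) : ℝ) / (N_J : ℝ)) * J_Max ≤ (((i : ℕ) : ℝ) / (N_T : ℝ)) * J_Max) ↔
        ((j : ℕ) * N_T) ⌈/⌉ N_J ≤ (i : ℕ) := by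
    intro i j
    have h1 : (0 : ℝ) < N_J := by exact_mod_cast hNJ
    have h2 : (0 : ℝ) < N_T := by exact_mod_cast hNT
    rw [mul_le_mul_iff_left₀ hJ, div_le_div_iff₀ h1 h2, ceilDiv_le_iff_le_mul hNJ]
    norm_cast
    first | rfl | rw [mul_comm N_J]
  have hb : ∀ j : Fin (N_J + 1), ((j : ℕ) * N_T) ⌈/⌉ N_J < N_T + 1 := by
    intro j
    rw [Nat.lt_succ_iff, ceilDiv_le_iff_le_mul hNJ]
    have := j.2
    exact Nat.mul_le_mul_right _ (by omega)
  obtain ⟨a, b, hab, hf⟩ := Fintype.exists_ne_map_eq_of_card_lt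
    (fun j : Fin (N_J + 1) => (⟨_, hb j⟩ : Fin (N_T + 1))) (by simpa using hlt)
  have hf' : ((a : ℕ) * N_T) ⌈/⌉ N_J = ((b : ℕ) * N_T) ⌈/⌉ N_J := by
    simpa using hf
  have hU : ∀ i : Fin (N_T + 1),
      Upay P_T N J_Max N_T N_J i a = Upay P_T N J_Max N_T N_J i b := by
    intro i
    simp only [Upay, key, hf']
  rcases lt_or_gt_of_ne (fun h => hab (Fin.ext h) : (a : ℕ) ≠ (b : ℕ)) with h | h
  · exact ⟨a, b, h, hU⟩
  · exact ⟨b, a, h, fun i => (hU i).symm⟩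
end
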